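/- Let 2 ≤ t ≤ m−2. An isometry g(x) = v + π(x) of F^n belongs to Aut({r + Ω(A^{t−1})}_{r∈V^t}) if and only if v ∈ B^t and π maps each column of the 2^t × 2^{m−t} array onto a column in such a way that, for each column, the image of the set of positions with even row index is either exactly the set of positions with even row index or exactly the set of positions with odd row index of the image column. -/

import Mathlib

open Finset Pointwise

abbrev Word (n : ℕ) := Fin n → ZMod 2

def FEv (n : ℕ) : Set (Word n) := {x | Even (hammingNorm x)}

def FOd (n : ℕ) : Set (Word n) := {x | ¬ Even (hammingNorm x)}

def nbr {n : ℕ} (S : Set (Word n)) : Set (Word n) := {y | ∃ x ∈ S, hammingDist y x = 1}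

def theta {n : ℕ} (G : Set (Word n)) : Set (Word n) :=
  {x | Even (hammingNorm x) ∧ nbr {x} ⊆ nbr G}

def ExtPerfect {n : ℕ} (C : Set (Word n)) : Prop :=
  C ⊆ FEv n ∧ (∀ x ∈ C, ∀ y ∈ C, x ≠ y → Disjoint (nbr {x}) (nbr {y})) ∧ nbr C = FOd n

def IsIsometry {n : ℕ} (g : Word n → Word n) : Prop :=
  Function.Bijective g ∧ ∀ x y, hammingDist (g x) (g y) = hammingDist x y

def embWord (m t : ℕ) (v : Word (2 ^ (m - t))) : Word (2 ^ m) := fun i =>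
  if h : (i : ℕ) < 2 ^ (m - t) then v ⟨i, h⟩
  else if h2 : (i : ℕ) < 2 * 2 ^ (m - t) then v ⟨(i : ℕ) - 2 ^ (m - t), by omega⟩
  else 0

def Vt (m t : ℕ) : Set (Word (2 ^ m)) :=
  {x | ∃ v : Word (2 ^ (m - t)), Even (hammingNorm v) ∧ x = embWord m t v}

def At (m : ℕ) : ℕ → Set (Word (2 ^ m))
  | 0 => {0}
  | 1 => Vt m 1
  | t + 2 => Vt m (t + 2) + At m (t + 1)

def IsComp (m t : ℕ) (G : Set (Word (2 ^ m))) : Prop :=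
  G ⊆ FEv (2 ^ m) ∧ G.ncard = (At m t).ncard ∧ nbr G = nbr (At m t)

def IsMuComp (m t : ℕ) (μ : Word (2 ^ m)) (M : Set (Word (2 ^ m))) : Prop :=
  (∀ i : Fin (2 ^ m), 2 ^ (m - t) ≤ (i : ℕ) → μ i = 0) ∧
  ∃ G, IsComp m t G ∧ M = (fun x => μ + x) '' G

def arrEntry (m t : ℕ) (x : Word (2 ^ m)) (i : Fin (2 ^ t)) (j : Fin (2 ^ (m - t))) : ZMod 2 :=
  x ⟨((i : ℕ) * 2 ^ (m - t) + (j : ℕ)) % 2 ^ m, Nat.mod_lt _ (Nat.two_pow_pos m)⟩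

def pchk (m t : ℕ) (x : Word (2 ^ m)) : Word (2 ^ (m - t)) :=
  fun j => ∑ i : Fin (2 ^ t), arrEntry m t x i j

def Bt (m : ℕ) : ℕ → Set (Word (2 ^ m))
  | 0 => Vt m 1
  | 1 => Vt m 1
  | t + 2 => Vt m (t + 2) + theta (At m (t + 1))

/-- Sums of the entries of a word over the classes of positions modulo `q`. -/
def colSum {n : ℕ} (q : ℕ) : Word n →+ (ℕ → ZMod 2) where
  toFun x a := ∑ i ∈ Finset.univ.filter (fun i : Fin n => (i : ℕ) % q = a), x i
  map_zero' := by ext a; simp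
  map_add' x y := by ext a; simp [Finset.sum_add_distrib]

lemma colSum_apply {n : ℕ} (q : ℕ) (x : Word n) (a : ℕ) :
    colSum q x a = ∑ i ∈ Finset.univ.filter (fun i : Fin n => (i : ℕ) % q = a), x i := rfl

/-- The word of weight one supported at `i`. -/
abbrev unitWord {n : ℕ} (i : Fin n) : Word n := Pi.single i 1

lemma colSum_unitWord {n : ℕ} (q : ℕ) (i : Fin n) (a : ℕ) :
    colSum q (unitWord i) a = if (i : ℕ) % q = a then 1 else 0 := by
  rw [colSum_apply, Finset.sum_filter, Finset.sum_eq_single i]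
  · simp
  · intro b _ hb
    simp [Pi.single_eq_of_ne hb]
  · simp

lemma colSum_eq_iff {n : ℕ} {q : ℕ} {x y : Word n} :
    colSum q x = colSum q y ↔
      ∀ l : Fin n, colSum q x ((l : ℕ) % q) = colSum q y ((l : ℕ) % q) := by
  refine ⟨fun h l => by rw [h], fun h => ?_⟩
  ext a
  by_cases ha : ∃ l : Fin n, (l : ℕ) % q = a
  · obtain ⟨l, rfl⟩ := ha
    exact h l
  · push Not at ha
    rw [colSum_apply, colSum_apply, Finset.filter_false_of_mem (by simpa using ha)]
    simp

lemma colSum_unitWord_eq_iff {n : ℕ} {q : ℕ} {i j : Fin n} :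
    colSum q (unitWord i) = colSum q (unitWord j) ↔ (i : ℕ) % q = (j : ℕ) % q := by
  constructor
  · intro h
    have := congrFun h ((i : ℕ) % q)
    rw [colSum_unitWord, colSum_unitWord, if_pos rfl] at this
    by_contra hne
    rw [if_neg (Ne.symm hne)] at this
    exact one_ne_zero this
  · intro h
    ext a
    rw [colSum_unitWord, colSum_unitWord, h]

/-- A permutation respecting the classes modulo `q` permutes the column sums. -/
lemma colSum_comp_perm {n : ℕ} {q : ℕ} {π : Equiv.Perm (Fin n)}
    (hπ : ∀ i i' : Fin n, (i : ℕ) % q = (i' : ℕ) % q ↔ (π i : ℕ) % q = (π i' : ℕ) % q)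
    (x : Word n) (i : Fin n) :
    colSum q (fun l => x (π l)) ((i : ℕ) % q) = colSum q x ((π i : ℕ) % q) := by
  rw [colSum_apply, colSum_apply]
  exact Finset.sum_equiv π (fun l => by simpa using hπ l i) (by simp)

lemma colSum_comp_perm_eq_iff {n : ℕ} {q : ℕ} {π : Equiv.Perm (Fin n)}
    (hπ : ∀ i i' : Fin n, (i : ℕ) % q = (i' : ℕ) % q ↔ (π i : ℕ) % q = (π i' : ℕ) % q)
    (x y : Word n) :
    colSum q (fun l => x (π l)) = colSum q (fun l => y (π l)) ↔ colSum q x = colSum q y := by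
  rw [colSum_eq_iff, colSum_eq_iff]
  simp only [colSum_comp_perm hπ]
  exact π.surjective.forall (p := fun l => colSum q x ((l : ℕ) % q) = colSum q y ((l : ℕ) % q)).symm

lemma unitWord_comp_perm {n : ℕ} (π : Equiv.Perm (Fin n)) (i : Fin n) :
    (fun l => (unitWord (π i) : Word n) (π l)) = unitWord i := by
  ext l
  simp [Pi.single_apply]

lemma mod_mul_two_cases (i k : ℕ) :
    ((i / k) % 2 = 0 ∧ i % (k * 2) = i % k) ∨ ((i / k) % 2 = 1 ∧ i % (k * 2) = i % k + k) := by
  rw [Nat.mod_mul]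
  rcases Nat.mod_two_eq_zero_or_one (i / k) with h | h <;> simp [h]

lemma mod_mul_two_eq_iff {i i' k : ℕ} :
    i % (k * 2) = i' % (k * 2) ↔ i % k = i' % k ∧ (i / k) % 2 = (i' / k) % 2 := by
  rcases Nat.eq_zero_or_pos k with rfl | hk
  · simp
  · have h1 := Nat.mod_lt i hk
    have h2 := Nat.mod_lt i' hk
    rcases mod_mul_two_cases i k with h | h <;> rcases mod_mul_two_cases i' k with h' | h' <;> omega

lemma colSum_eq_add {n : ℕ} {k a : ℕ} (ha : a < k) (x : Word n) :
    colSum k x a = colSum (k * 2) x a + colSum (k * 2) x (a + k) := by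
  rw [colSum_apply, colSum_apply, colSum_apply, ← Finset.sum_union]
  · congr 1
    ext i
    have h1 := Nat.mod_lt (i : ℕ) (Nat.zero_lt_of_lt ha)
    simp only [Finset.mem_filter_univ, Finset.mem_union]
    rcases mod_mul_two_cases i k with h | h <;> omega
  · rw [Finset.disjoint_left]
    intro i
    simp only [Finset.mem_filter_univ]
    omega

lemma colSum_of_le {n : ℕ} {q a : ℕ} (hq : 0 < q) (ha : q ≤ a) (x : Word n) :
    colSum q x a = 0 := by
  rw [colSum_apply, Finset.filter_false_of_mem, Finset.sum_empty]
  intro i _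
  have := Nat.mod_lt (i : ℕ) hq
  omega

lemma two_pow_sub_mul_two {m t : ℕ} (ht : 1 ≤ t) (htm : t ≤ m) :
    2 ^ (m - (t - 1)) = 2 ^ (m - t) * 2 := by
  rw [← pow_succ]
  congr 1
  omega

lemma embWord_eq (m t : ℕ) (u : Word (2 ^ (m - t))) (i : Fin (2 ^ m)) :
    embWord m t u i = if (i : ℕ) < 2 ^ (m - t) * 2 then
      u ⟨(i : ℕ) % 2 ^ (m - t), Nat.mod_lt _ (Nat.two_pow_pos _)⟩ else 0 := by
  unfold embWord
  split_ifs with h1 h2 h3 h4 h5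
  · congr 2
    exact (Nat.mod_eq_of_lt h1).symm
  · omega
  · congr 2
    rw [Nat.mod_eq_sub_mod (by omega), Nat.mod_eq_of_lt (by omega)]
  · omega
  · omega
  · rfl

lemma colSum_embWord {m t : ℕ} (ht : 1 ≤ t) (htm : t ≤ m) (u : Word (2 ^ (m - t))) {a : ℕ}
    (ha : a < 2 ^ (m - t) * 2) :
    colSum (2 ^ (m - t) * 2) (embWord m t u) a =
      u ⟨a % 2 ^ (m - t), Nat.mod_lt _ (Nat.two_pow_pos _)⟩ := by
  have hle : 2 ^ (m - t) * 2 ≤ 2 ^ m := by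
    rw [← pow_succ]
    exact Nat.pow_le_pow_right (by norm_num) (by omega)
  rw [colSum_apply, Finset.sum_eq_single ⟨a, by omega⟩]
  · rw [embWord_eq, if_pos ha]
  · intro b hb hba
    rw [embWord_eq, if_neg]
    intro hlt
    rw [Finset.mem_filter_univ, Nat.mod_eq_of_lt hlt] at hb
    exact hba (Fin.ext hb)
  · intro h
    rw [Finset.mem_filter_univ] at h
    exact absurd (Nat.mod_eq_of_lt ha) h

lemma even_hammingNorm_iff {n : ℕ} (x : Word n) : Even (hammingNorm x) ↔ ∑ i, x i = 0 := by
  have h : ∑ i, x i = (hammingNorm x : ZMod 2) := by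
    rw [hammingNorm, Finset.card_filter, Nat.cast_sum]
    refine Finset.sum_congr rfl fun i _ => ?_
    generalize x i = b
    revert b
    decide
  rw [h, ZMod.natCast_eq_zero_iff_even]

lemma hammingDist_eq_one_iff {n : ℕ} (y x : Word n) :
    hammingDist y x = 1 ↔ ∃ i, y = x + unitWord i := by
  rw [hammingDist, Finset.card_eq_one]
  refine exists_congr fun i => ?_
  rw [Finset.ext_iff, funext_iff]
  refine forall_congr' fun l => ?_
  simp only [Finset.mem_filter_univ, Finset.mem_singleton, Pi.add_apply, Pi.single_apply]
  generalize x l = b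
  generalize y l = c
  by_cases h : l = i <;> simp only [h] <;> revert b c <;> decide

lemma At_succ (m s : ℕ) : At m (s + 1) = Vt m (s + 1) + At m s := by
  cases s with
  | zero => simp [At]
  | succ s => rfl

lemma Bt_of_two_le (m : ℕ) {t : ℕ} (ht : 2 ≤ t) : Bt m t = Vt m t + theta (At m (t - 1)) := by
  obtain ⟨s, rfl⟩ := Nat.exists_eq_add_of_le' ht
  rfl

lemma add_self_word {n : ℕ} (x : Word n) : x + x = 0 := by
  ext i
  simp [CharTwo.add_self_eq_zero]

lemma colSum_add_self {n : ℕ} (q : ℕ) (x : Word n) : colSum q x + colSum q x = 0 := by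
  rw [← map_add, add_self_word, map_zero]

lemma colSum_At {m s : ℕ} (hs : s ≤ m) {x : Word (2 ^ m)} (hx : x ∈ At m s) :
    colSum (2 ^ (m - s)) x = 0 := by
  induction s generalizing x with
  | zero =>
    rw [Set.mem_singleton_iff.mp hx, map_zero]
  | succ s ih =>
    rw [At_succ] at hx
    obtain ⟨_, ⟨u, -, rfl⟩, z, hz, rfl⟩ := hx
    have hz' := ih (by omega) hz
    have hk := two_pow_sub_mul_two (Nat.le_add_left 1 s) hs
    rw [Nat.add_sub_cancel] at hk
    rw [hk] at hz'
    ext a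
    rcases lt_or_ge a (2 ^ (m - (s + 1))) with ha | ha
    · rw [colSum_eq_add ha, map_add, hz', add_zero, colSum_embWord (by omega) hs u (by omega),
        colSum_embWord (by omega) hs u (by omega)]
      simp [CharTwo.add_self_eq_zero]
    · exact colSum_of_le (Nat.two_pow_pos _) ha _

/-- A word whose sums modulo `k` form a unit vector can be corrected by an even word, repeated in
the two halves of its sums modulo `k * 2`, so that the latter form a unit vector too. -/
lemma exists_even_word_colSum_add {n k : ℕ} (hkpos : 0 < k) (hle : k * 2 ≤ n) {y : Word n}
    {i : Fin n} (hi : colSum k y = colSum k (unitWord i)) :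
    ∃ u : Word k, Even (hammingNorm u) ∧ ∃ l : Fin n, ∀ r : Word n,
      (∀ a < k * 2, colSum (k * 2) r a = u ⟨a % k, Nat.mod_lt _ hkpos⟩) →
        colSum (k * 2) (y + r) = colSum (k * 2) (unitWord l) := by
  set j := (i : ℕ) % k with hj
  have hjk : j < k := Nat.mod_lt _ hkpos
  have hsplit : ∀ a < k, colSum (k * 2) y (a + k) =
      colSum (k * 2) y a + if j = a then 1 else 0 := by
    intro a ha
    have h1 := congrFun hi a
    rw [colSum_eq_add ha, colSum_unitWord] at h1
    rw [← h1, ← add_assoc, CharTwo.add_self_eq_zero, zero_add]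
  have hmod : ∀ a, a < k → (a + k) % k = a := fun a ha => by
    rw [Nat.add_mod_right, Nat.mod_eq_of_lt ha]
  by_cases hpar : ∑ a : Fin k, colSum (k * 2) y (a : ℕ) = 0
  · refine ⟨fun a => colSum (k * 2) y a, (even_hammingNorm_iff _).mpr hpar,
      ⟨j + k, by omega⟩, fun r hr => ?_⟩
    ext a
    rw [map_add, Pi.add_apply, colSum_unitWord, Nat.mod_eq_of_lt (by simp; omega)]
    rcases lt_or_ge a (k * 2) with ha | ha
    · rw [hr a ha]
      rcases lt_or_ge a k with h | h
      · simp only [Nat.mod_eq_of_lt h, CharTwo.add_self_eq_zero]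
        rw [if_neg (by omega)]
      · obtain ⟨b, rfl⟩ := Nat.exists_eq_add_of_le' h
        simp only [hmod b (by omega), hsplit b (by omega)]
        rw [add_right_comm, CharTwo.add_self_eq_zero, zero_add]
        simp
    · rw [colSum_of_le (by omega) ha, colSum_of_le (by omega) ha, if_neg (by simp; omega),
        add_zero]
  · refine ⟨fun a => colSum (k * 2) y a + if j = a then 1 else 0,
      (even_hammingNorm_iff _).mpr ?_, ⟨j, by omega⟩, fun r hr => ?_⟩
    · have h1 : ∑ b : Fin k, (if j = (b : ℕ) then (1 : ZMod 2) else 0) = 1 := by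
        rw [Finset.sum_eq_single (⟨j, hjk⟩ : Fin k) _ (by simp)]
        · simp
        · exact fun b _ hb => if_neg fun h => hb (Fin.ext h.symm)
      have h2 : ∀ b : ZMod 2, b ≠ 0 → b + 1 = 0 := by decide
      rw [Finset.sum_add_distrib, h1]
      exact h2 _ hpar
    ext a
    rw [map_add, Pi.add_apply, colSum_unitWord, Nat.mod_eq_of_lt (by simp; omega)]
    rcases lt_or_ge a (k * 2) with ha | ha
    · rw [hr a ha]
      rcases lt_or_ge a k with h | h
      · simp only [Nat.mod_eq_of_lt h]
        rw [← add_assoc, CharTwo.add_self_eq_zero, zero_add]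
      · obtain ⟨b, rfl⟩ := Nat.exists_eq_add_of_le' h
        simp only [hmod b (by omega), hsplit b (by omega), CharTwo.add_self_eq_zero]
        rw [if_neg (by omega)]
    · rw [colSum_of_le (by omega) ha, colSum_of_le (by omega) ha, if_neg (by simp; omega),
        add_zero]

lemma exists_add_unitWord_mem_At {m s : ℕ} (hs : s ≤ m) {y : Word (2 ^ m)}
    (hy : ∃ i : Fin (2 ^ m), colSum (2 ^ (m - s)) y = colSum (2 ^ (m - s)) (unitWord i)) :
    ∃ i, y + unitWord i ∈ At m s := by
  induction s generalizing y with
  | zero =>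
    obtain ⟨i, hi⟩ := hy
    refine ⟨i, ?_⟩
    suffices h : y = unitWord i by
      rw [h, add_self_word]
      rfl
    have key : ∀ (x : Word (2 ^ m)) (l : Fin (2 ^ m)), colSum (2 ^ (m - 0)) x l = x l := by
      intro x l
      rw [colSum_apply, Finset.sum_filter, Finset.sum_eq_single l]
      · simp [Nat.mod_eq_of_lt l.isLt]
      · intro b _ hb
        rw [if_neg]
        rw [Nat.sub_zero, Nat.mod_eq_of_lt b.isLt]
        exact fun h => hb (Fin.ext h)
      · simp
    ext l
    rw [← key y, hi, key]
  | succ s ih =>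
    obtain ⟨i, hi⟩ := hy
    have hk := two_pow_sub_mul_two (Nat.le_add_left 1 s) hs
    rw [Nat.add_sub_cancel] at hk
    have hle : 2 ^ (m - (s + 1)) * 2 ≤ 2 ^ m := by
      rw [← hk]
      exact Nat.pow_le_pow_right (by norm_num) (by omega)
    have hkpos := Nat.two_pow_pos (m - (s + 1))
    simp only [hk] at ih
    suffices h : ∃ u : Word (2 ^ (m - (s + 1))), Even (hammingNorm u) ∧ ∃ l : Fin (2 ^ m),
        colSum (2 ^ (m - (s + 1)) * 2) (y + embWord m (s + 1) u) =
          colSum (2 ^ (m - (s + 1)) * 2) (unitWord l) by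
      obtain ⟨u, hu, l, hl⟩ := h
      obtain ⟨l', hl'⟩ := ih (by omega) ⟨l, hl⟩
      refine ⟨l', ?_⟩
      rw [At_succ]
      refine ⟨_, ⟨u, hu, rfl⟩, _, hl', ?_⟩
      change embWord m (s + 1) u + (y + embWord m (s + 1) u + unitWord l') = _
      rw [show embWord m (s + 1) u + (y + embWord m (s + 1) u + unitWord l') =
        embWord m (s + 1) u + embWord m (s + 1) u + (y + unitWord l') by abel, add_self_word,
        zero_add]
    obtain ⟨u, hu, l, hl⟩ := exists_even_word_colSum_add hkpos hle hi
    exact ⟨u, hu, l, hl _ fun a ha => colSum_embWord (by omega) hs u ha⟩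

lemma mem_nbr_At {m s : ℕ} (hs : s ≤ m) (y : Word (2 ^ m)) :
    y ∈ nbr (At m s) ↔
      ∃ i : Fin (2 ^ m), colSum (2 ^ (m - s)) y = colSum (2 ^ (m - s)) (unitWord i) := by
  constructor
  · rintro ⟨x, hx, hd⟩
    obtain ⟨i, rfl⟩ := (hammingDist_eq_one_iff _ _).mp hd
    exact ⟨i, by rw [map_add, colSum_At hs hx, zero_add]⟩
  · intro h
    obtain ⟨i, hi⟩ := exists_add_unitWord_mem_At hs h
    refine ⟨_, hi, (hammingDist_eq_one_iff _ _).mpr ⟨i, ?_⟩⟩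
    rw [add_assoc, add_self_word, add_zero]

lemma eq_zero_of_forall_add_unit {n q : ℕ} (hq : 3 ≤ q) (hn : q ≤ n) {w : ℕ → ZMod 2}
    (h : ∀ i : Fin n, ∃ l : Fin n,
      w + colSum q (unitWord i) = colSum q (unitWord l)) : w = 0 := by
  obtain ⟨l0, h0⟩ := h ⟨0, by omega⟩
  have hw : ∀ a, w a = (if (l0 : ℕ) % q = a then 1 else 0) + if 0 = a then 1 else 0 := by
    intro a
    have := congrFun h0 a
    rw [Pi.add_apply, colSum_unitWord, colSum_unitWord, Nat.zero_mod] at this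
    rw [← this, add_assoc, CharTwo.add_self_eq_zero, add_zero]
  by_cases hl : (l0 : ℕ) % q = 0
  · ext a
    rw [hw, hl, CharTwo.add_self_eq_zero, Pi.zero_apply]
  · exfalso
    obtain ⟨b, hb, hb0, hbl⟩ : ∃ b < q, b ≠ 0 ∧ b ≠ (l0 : ℕ) % q := by
      by_cases h1 : (l0 : ℕ) % q = 1
      · exact ⟨2, by omega, by omega, by omega⟩
      · exact ⟨1, by omega, by omega, by omega⟩
    obtain ⟨l, hl'⟩ := h ⟨b, by omega⟩
    have e1 := congrFun hl' 0
    have e2 := congrFun hl' ((l0 : ℕ) % q)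
    simp only [Pi.add_apply, colSum_unitWord, hw, Nat.mod_eq_of_lt hb, if_neg hl, if_neg hb0,
      if_neg hbl, if_neg (Ne.symm hl), if_true, zero_add, add_zero] at e1 e2
    have f1 : (l : ℕ) % q = 0 := by
      by_contra hne
      simp [hne] at e1
    rw [f1, if_neg (Ne.symm hl)] at e2
    exact one_ne_zero e2

lemma mem_theta_At {m s : ℕ} (hs : s ≤ m) (hq : 3 ≤ 2 ^ (m - s)) (x : Word (2 ^ m)) :
    x ∈ theta (At m s) ↔ colSum (2 ^ (m - s)) x = 0 := by
  constructor
  · rintro ⟨-, h⟩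
    refine eq_zero_of_forall_add_unit hq (n := 2 ^ m)
      (Nat.pow_le_pow_right (by norm_num) (by omega)) fun i => ?_
    rw [← map_add]
    exact (mem_nbr_At hs _).mp (h ⟨x, rfl, (hammingDist_eq_one_iff _ _).mpr ⟨i, rfl⟩⟩)
  · intro h
    refine ⟨(even_hammingNorm_iff _).mpr ?_, ?_⟩
    · rw [← Finset.sum_fiberwise_of_maps_to (t := Finset.range (2 ^ (m - s)))
        (g := fun i : Fin (2 ^ m) => (i : ℕ) % 2 ^ (m - s))]
      · exact Finset.sum_eq_zero fun a _ => congrFun h a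
      · intro i _
        exact Finset.mem_range.mpr (Nat.mod_lt _ (by omega))
    · rintro y ⟨_, rfl, hd⟩
      obtain ⟨i, rfl⟩ := (hammingDist_eq_one_iff _ _).mp hd
      exact (mem_nbr_At hs _).mpr ⟨i, by rw [map_add, h, zero_add]⟩

lemma mem_translate_nbr_At {m s : ℕ} (hs : s ≤ m) (r y : Word (2 ^ m)) :
    y ∈ (fun z => r + z) '' nbr (At m s) ↔ ∃ i : Fin (2 ^ m),
      colSum (2 ^ (m - s)) y = colSum (2 ^ (m - s)) r + colSum (2 ^ (m - s)) (unitWord i) := by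
  constructor
  · rintro ⟨z, hz, rfl⟩
    obtain ⟨i, hi⟩ := (mem_nbr_At hs _).mp hz
    exact ⟨i, by rw [map_add, hi]⟩
  · rintro ⟨i, hi⟩
    refine ⟨r + y, (mem_nbr_At hs _).mpr ⟨i, ?_⟩, ?_⟩
    · rw [map_add, hi, ← add_assoc, colSum_add_self, zero_add]
    · change r + (r + y) = y
      rw [← add_assoc, add_self_word, zero_add]

lemma isometry_surjective {n : ℕ} (v : Word n) (π : Equiv.Perm (Fin n)) :
    Function.Surjective fun x : Word n => v + fun i => x (π i) := by
  intro y
  refine ⟨fun i => (v + y) (π.symm i), ?_⟩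
  ext i
  simp [← add_assoc, CharTwo.add_self_eq_zero]

lemma isometry_injective {n : ℕ} (v : Word n) (π : Equiv.Perm (Fin n)) :
    Function.Injective fun x : Word n => v + fun i => x (π i) := by
  intro x y h
  ext i
  have := congrFun (add_left_cancel h) (π.symm i)
  simpa using this

lemma zero_mem_Vt (m t : ℕ) : (0 : Word (2 ^ m)) ∈ Vt m t := by
  refine ⟨0, by simp, ?_⟩
  ext i
  rw [embWord_eq]
  simp

lemma colSum_Vt_eq {m t : ℕ} (ht : 1 ≤ t) (htm : t ≤ m) {r : Word (2 ^ m)} (hr : r ∈ Vt m t)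
    {i i' : ℕ} (h : i % 2 ^ (m - t) = i' % 2 ^ (m - t)) :
    colSum (2 ^ (m - t) * 2) r (i % (2 ^ (m - t) * 2)) =
      colSum (2 ^ (m - t) * 2) r (i' % (2 ^ (m - t) * 2)) := by
  obtain ⟨u, -, rfl⟩ := hr
  have hk := Nat.two_pow_pos (m - t)
  rw [colSum_embWord ht htm u (Nat.mod_lt _ (by omega)),
    colSum_embWord ht htm u (Nat.mod_lt _ (by omega))]
  simp only [Nat.mod_mul_right_mod, h]

/-- The isometry `x ↦ v + x ∘ π` maps the translate of the neighborhood of `At m s` by `r`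
onto the one by `r'`, expressed through column sums. -/
lemma image_translate_eq_iff {m s : ℕ} (hs : s ≤ m) (v r r' : Word (2 ^ m))
    (π : Equiv.Perm (Fin (2 ^ m))) :
    (fun x : Word (2 ^ m) => v + fun i => x (π i)) '' ((fun z => r + z) '' nbr (At m s)) =
        (fun z => r' + z) '' nbr (At m s) ↔
      ∀ x : Word (2 ^ m),
        (∃ i : Fin (2 ^ m), colSum (2 ^ (m - s)) x =
            colSum (2 ^ (m - s)) r + colSum (2 ^ (m - s)) (unitWord i)) ↔
        ∃ i : Fin (2 ^ m), colSum (2 ^ (m - s)) v + colSum (2 ^ (m - s)) (fun l => x (π l)) =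
            colSum (2 ^ (m - s)) r' + colSum (2 ^ (m - s)) (unitWord i) := by
  rw [Set.ext_iff, (isometry_surjective v π).forall]
  refine forall_congr' fun x => ?_
  rw [(isometry_injective v π).mem_set_image, mem_translate_nbr_At hs, mem_translate_nbr_At hs,
    map_add]

/-- for 2 ≤ t ≤ m-2, an isometry g(x) = v + π(x) belongs to
Aut({r + Ω(A^{t-1})}_{r ∈ V^t}) iff v ∈ B^t and π maps each column onto a column so that
on each column the even-row positions go exactly onto the even-row positions or exactly
onto the odd-row positions of the image column. -/
theorem stmt_13 (m t : ℕ) (hm : 4 ≤ m) (ht : 2 ≤ t) (ht' : t ≤ m - 2)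
    (v : Word (2 ^ m)) (π : Equiv.Perm (Fin (2 ^ m))) :
    (∀ S ∈ {S : Set (Word (2 ^ m)) |
        ∃ r ∈ Vt m t, S = (fun y => r + y) '' nbr (At m (t - 1))},
      (fun x : Word (2 ^ m) => v + fun i => x (π i)) '' S ∈
        {S : Set (Word (2 ^ m)) |
          ∃ r ∈ Vt m t, S = (fun y => r + y) '' nbr (At m (t - 1))}) ↔
    (v ∈ Bt m t ∧ ∃ ψ : Equiv.Perm (Fin (2 ^ (m - t))),
      (∀ i : Fin (2 ^ m),
        ((π i : ℕ) % 2 ^ (m - t))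
          = (ψ ⟨(i : ℕ) % 2 ^ (m - t), Nat.mod_lt _ (Nat.two_pow_pos (m - t))⟩ : ℕ)) ∧
      ∀ j : Fin (2 ^ (m - t)),
        (∀ i : Fin (2 ^ m), (i : ℕ) % 2 ^ (m - t) = (j : ℕ) →
          ((i : ℕ) / 2 ^ (m - t)) % 2 = ((π i : ℕ) / 2 ^ (m - t)) % 2) ∨
        (∀ i : Fin (2 ^ m), (i : ℕ) % 2 ^ (m - t) = (j : ℕ) →
          ((i : ℕ) / 2 ^ (m - t)) % 2 ≠ ((π i : ℕ) / 2 ^ (m - t)) % 2)) := by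
  have htm : t ≤ m := by omega
  have hq2 := two_pow_sub_mul_two (by omega : 1 ≤ t) htm
  have hk4 : 2 ^ 2 ≤ 2 ^ (m - t) := Nat.pow_le_pow_right (by norm_num) (by omega)
  have hqn : 2 ^ (m - t) * 2 ≤ 2 ^ m := by
    rw [← hq2]
    exact Nat.pow_le_pow_right (by norm_num) (by omega)
  have himg := fun r r' => image_translate_eq_iff (by omega : t - 1 ≤ m) v r r' π
  have htheta := mem_theta_At (by omega : t - 1 ≤ m) (by omega)
  rw [Bt_of_two_le m ht]
  simp only [hq2] at himg htheta
  simp only [Set.mem_ofPred_eq, forall_exists_index, and_imp]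
  have hVeq := fun (r : Word (2 ^ m)) (hr : r ∈ Vt m t) (i i' : ℕ) =>
    colSum_Vt_eq (by omega : 1 ≤ t) htm hr (i := i) (i' := i')
  constructor
  · intro H
    have key : ∀ r ∈ Vt m t, ∃ r' ∈ Vt m t,
        colSum (2 ^ (m - t) * 2) v + colSum (2 ^ (m - t) * 2) (fun l => r (π l)) =
          colSum (2 ^ (m - t) * 2) r' ∧
        ∀ x : Word (2 ^ m),
        (∃ i : Fin (2 ^ m), colSum (2 ^ (m - t) * 2) x =
            colSum (2 ^ (m - t) * 2) r + colSum (2 ^ (m - t) * 2) (unitWord i)) ↔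
        ∃ i : Fin (2 ^ m), colSum (2 ^ (m - t) * 2) v +
            colSum (2 ^ (m - t) * 2) (fun l => x (π l)) =
            colSum (2 ^ (m - t) * 2) r' + colSum (2 ^ (m - t) * 2) (unitWord i) := by
      intro r hr
      obtain ⟨r', hr', h⟩ := H _ r hr rfl
      rw [himg] at h
      refine ⟨r', hr', ?_, h⟩
      have hz : colSum (2 ^ (m - t) * 2) v + colSum (2 ^ (m - t) * 2) (fun l => r (π l)) +
          colSum (2 ^ (m - t) * 2) r' = 0 := by
        refine eq_zero_of_forall_add_unit (by omega) hqn fun i => ?_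
        obtain ⟨l, hl⟩ := (h (r + unitWord (π i))).mp ⟨π i, map_add _ _ _⟩
        refine ⟨l, ?_⟩
        have e : (fun l => (r + unitWord (π i)) (π l)) = (fun l => r (π l)) + unitWord i := by
          rw [← unitWord_comp_perm π i]
          rfl
        rw [e, map_add] at hl
        rw [add_right_comm, add_assoc (colSum _ v), hl, add_right_comm, colSum_add_self, zero_add]
      rw [← sub_eq_zero, sub_eq_add_neg, neg_eq_of_add_eq_zero_left (colSum_add_self _ r'), hz]
    obtain ⟨r0, hr0, hv, hunit⟩ := key 0 (zero_mem_Vt m t)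
    have hv' : colSum (2 ^ (m - t) * 2) v = colSum (2 ^ (m - t) * 2) r0 := by
      rw [← hv, show (fun l => (0 : Word (2 ^ m)) (π l)) = 0 from rfl, map_zero, add_zero]
    simp only [hv', map_zero, zero_add, add_right_inj] at hunit
    have hker : ∀ x : Word (2 ^ m), colSum (2 ^ (m - t) * 2) x = 0 ↔
        colSum (2 ^ (m - t) * 2) (fun l => x (π l)) = 0 := by
      intro x
      have e : ∀ i, (fun l => (x + unitWord (π i)) (π l)) = (fun l => x (π l)) + unitWord i := by
        intro i
        rw [← unitWord_comp_perm π i]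
        rfl
      constructor
      · intro hx
        refine eq_zero_of_forall_add_unit (by omega) hqn fun i => ?_
        rw [← map_add, ← e]
        exact (hunit _).mp ⟨π i, by rw [map_add, hx, zero_add]⟩
      · intro hx
        refine eq_zero_of_forall_add_unit (by omega) hqn fun i => ?_
        rw [← map_add]
        refine (hunit _).mpr ⟨π.symm i, ?_⟩
        have e' := e (π.symm i)
        rw [Equiv.apply_symm_apply] at e'
        rw [e', map_add, hx, zero_add]
    have hclass : ∀ i i' : Fin (2 ^ m),
        (i : ℕ) % (2 ^ (m - t) * 2) = (i' : ℕ) % (2 ^ (m - t) * 2) ↔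
        (π i : ℕ) % (2 ^ (m - t) * 2) = (π i' : ℕ) % (2 ^ (m - t) * 2) := by
      intro i i'
      have hsum : ∀ l l' : Fin (2 ^ m), colSum (2 ^ (m - t) * 2) (unitWord l + unitWord l') = 0 ↔
          (l : ℕ) % (2 ^ (m - t) * 2) = (l' : ℕ) % (2 ^ (m - t) * 2) := by
        intro l l'
        rw [← colSum_unitWord_eq_iff, map_add, add_eq_zero_iff_eq_neg,
          neg_eq_of_add_eq_zero_left (colSum_add_self _ _)]
      have h := hker (unitWord (π i) + unitWord (π i'))
      have e : (fun l => (unitWord (π i) + unitWord (π i') : Word (2 ^ m)) (π l)) =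
          unitWord i + unitWord i' := by
        rw [← unitWord_comp_perm π i, ← unitWord_comp_perm π i']
        rfl
      rw [← hsum, ← hsum, h, e]
    have hcol : ∀ i i' : Fin (2 ^ m), (i : ℕ) % 2 ^ (m - t) = (i' : ℕ) % 2 ^ (m - t) →
        (π i : ℕ) % 2 ^ (m - t) = (π i' : ℕ) % 2 ^ (m - t) := by
      intro i i' hii
      by_contra hne
      have hkpos := Nat.two_pow_pos (m - t)
      set a : Fin (2 ^ (m - t)) := ⟨(π i : ℕ) % 2 ^ (m - t), Nat.mod_lt _ hkpos⟩ with ha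
      set b : Fin (2 ^ (m - t)) := ⟨(π i' : ℕ) % 2 ^ (m - t), Nat.mod_lt _ hkpos⟩ with hb
      have hab : a ≠ b := fun h => hne (congrArg Fin.val h)
      obtain ⟨c, hca, hcb⟩ : ∃ c : Fin (2 ^ (m - t)), c ≠ a ∧ c ≠ b := by
        have hcard : ({a, b} : Finset (Fin (2 ^ (m - t)))).card <
            (Finset.univ : Finset (Fin (2 ^ (m - t)))).card := by
          rw [Finset.card_univ, Fintype.card_fin]
          exact lt_of_le_of_lt Finset.card_le_two (by omega)
        obtain ⟨c, -, hc⟩ := Finset.exists_mem_notMem_of_card_lt_card hcard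
        simp only [Finset.mem_insert, Finset.mem_singleton, not_or] at hc
        exact ⟨c, hc⟩
      have hmem : embWord m t (unitWord a + unitWord c) ∈ Vt m t := by
        refine ⟨_, (even_hammingNorm_iff _).mpr ?_, rfl⟩
        simp [Finset.sum_add_distrib, CharTwo.add_self_eq_zero]
      obtain ⟨r', hr', hrr, -⟩ := key _ hmem
      have e1 := congrFun hrr ((i : ℕ) % (2 ^ (m - t) * 2))
      have e2 := congrFun hrr ((i' : ℕ) % (2 ^ (m - t) * 2))
      rw [Pi.add_apply, colSum_comp_perm hclass, hv'] at e1 e2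
      rw [hVeq _ hr' _ _ hii, hVeq _ hr0 _ _ hii, ← e2, add_right_inj,
        colSum_embWord (by omega) htm _ (Nat.mod_lt _ (by omega)),
        colSum_embWord (by omega) htm _ (Nat.mod_lt _ (by omega))] at e1
      simp only [Nat.mod_mul_right_mod, ← ha, ← hb] at e1
      simp [Pi.single_eq_of_ne hab.symm, Pi.single_eq_of_ne hca.symm,
        Pi.single_eq_of_ne hcb.symm] at e1
    refine ⟨⟨r0, hr0, r0 + v, (htheta _).mpr ?_, ?_⟩, ?_⟩
    · rw [map_add, hv', colSum_add_self]
    · change r0 + (r0 + v) = v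
      rw [← add_assoc, add_self_word, zero_add]
    have hkpos := Nat.two_pow_pos (m - t)
    have hkn : 2 ^ (m - t) ≤ 2 ^ m := by omega
    let f : Fin (2 ^ (m - t)) → Fin (2 ^ (m - t)) := fun j =>
      ⟨(π (Fin.castLE hkn j) : ℕ) % 2 ^ (m - t), Nat.mod_lt _ hkpos⟩
    have hf : ∀ i : Fin (2 ^ m), (π i : ℕ) % 2 ^ (m - t) =
        (f ⟨(i : ℕ) % 2 ^ (m - t), Nat.mod_lt _ hkpos⟩ : ℕ) := fun i =>
      hcol _ _ (by simp)
    have hsurj : Function.Surjective f := by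
      intro j
      refine ⟨⟨(π.symm (Fin.castLE hkn j) : ℕ) % 2 ^ (m - t), Nat.mod_lt _ hkpos⟩, Fin.ext ?_⟩
      rw [← hf, Equiv.apply_symm_apply]
      exact Nat.mod_eq_of_lt j.isLt
    refine ⟨Equiv.ofBijective f ⟨Finite.injective_iff_surjective.mpr hsurj, hsurj⟩, hf, ?_⟩
    intro j
    have hj : ((Fin.castLE hkn j : Fin (2 ^ m)) : ℕ) % 2 ^ (m - t) = j :=
      Nat.mod_eq_of_lt j.isLt
    have hj0 : ((Fin.castLE hkn j : Fin (2 ^ m)) : ℕ) / 2 ^ (m - t) % 2 = 0 := by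
      rw [Fin.val_castLE, Nat.div_eq_of_lt j.isLt]
    have hpar : ∀ i : Fin (2 ^ m), (i : ℕ) % 2 ^ (m - t) = (j : ℕ) →
        ((i : ℕ) / 2 ^ (m - t) % 2 = 0 ↔ (π i : ℕ) / 2 ^ (m - t) % 2 =
          (π (Fin.castLE hkn j) : ℕ) / 2 ^ (m - t) % 2) := by
      intro i hi
      have h := hclass i (Fin.castLE hkn j)
      rw [mod_mul_two_eq_iff, mod_mul_two_eq_iff, hj, hj0] at h
      have h' := hcol i (Fin.castLE hkn j) (hi.trans hj.symm)
      tauto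
    rcases Nat.mod_two_eq_zero_or_one ((π (Fin.castLE hkn j) : ℕ) / 2 ^ (m - t)) with h0 | h0
    · left
      intro i hi
      have := hpar i hi
      omega
    · right
      intro i hi
      have := hpar i hi
      omega
  · rintro ⟨⟨r0, ⟨u0, hu0, rfl⟩, z, hz, rfl⟩, ψ, hψ, hpar⟩ S r ⟨u, hu, rfl⟩ rfl
    have hz' := (htheta z).mp hz
    have hclass : ∀ i i' : Fin (2 ^ m),
        (i : ℕ) % (2 ^ (m - t) * 2) = (i' : ℕ) % (2 ^ (m - t) * 2) ↔
        (π i : ℕ) % (2 ^ (m - t) * 2) = (π i' : ℕ) % (2 ^ (m - t) * 2) := by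
      intro i i'
      rw [mod_mul_two_eq_iff, mod_mul_two_eq_iff]
      have hc : (i : ℕ) % 2 ^ (m - t) = (i' : ℕ) % 2 ^ (m - t) ↔
          (π i : ℕ) % 2 ^ (m - t) = (π i' : ℕ) % 2 ^ (m - t) := by
        rw [hψ, hψ, Fin.val_inj, ψ.apply_eq_iff_eq, Fin.mk.injEq]
      rw [← hc]
      refine and_congr_right fun hii => ?_
      rcases hpar ⟨(i' : ℕ) % 2 ^ (m - t), Nat.mod_lt _ (Nat.two_pow_pos _)⟩ with h | h
      · rw [h i hii, h i' rfl]
      · have h1 := h i hii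
        have h2 := h i' rfl
        omega
    refine ⟨embWord m t (u0 + fun j => u (ψ j)), ⟨_, ?_, rfl⟩, ?_⟩
    · rw [even_hammingNorm_iff] at hu hu0 ⊢
      simp only [Pi.add_apply, Finset.sum_add_distrib]
      rw [hu0, Equiv.sum_comp ψ u, hu, add_zero]
    have hr' : colSum (2 ^ (m - t) * 2) (embWord m t (u0 + fun j => u (ψ j))) =
        colSum (2 ^ (m - t) * 2)
          (embWord m t u0 + z + fun l => embWord m t u (π l)) := by
      rw [colSum_eq_iff]
      intro l
      rw [map_add, map_add, hz', add_zero, Pi.add_apply, colSum_comp_perm hclass,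
        colSum_embWord (by omega) htm _ (Nat.mod_lt _ (by omega)),
        colSum_embWord (by omega) htm _ (Nat.mod_lt _ (by omega)),
        colSum_embWord (by omega) htm _ (Nat.mod_lt _ (by omega))]
      simp only [Nat.mod_mul_right_mod, Pi.add_apply, hψ]
    refine (himg _ _).mpr fun x => ?_
    have e : ∀ i, (fun l => (embWord m t u + unitWord (π i)) (π l)) =
        (fun l => embWord m t u (π l)) + unitWord i := by
      intro i
      rw [← unitWord_comp_perm π i]
      rfl
    rw [hr', π.surjective.exists]
    refine exists_congr fun i => ?_
    simp only [map_add _ (_ + z)]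
    rw [add_assoc, add_right_inj, ← map_add, ← map_add, ← e,
      colSum_comp_perm_eq_iff hclass]
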